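/- arXiv:1409.6806 — 10 statements merged into one kernel-verified Lean document; each statement's English description precedes it below -/
import Mathlib

section
/- Let A be a real symmetric n×n matrix with n distinct eigenvalues, and let u_1, …, u_n be an orthonormal basis of eigenvectors of A. Suppose exactly k of these eigenvectors u_i satisfy u_iᵀ𝟏 = 0 (where 𝟏 is the all-ones vector), and each of these k eigenvectors has at least 2k+1 nonzero entries. Then the only doubly stochastic matrix Q satisfying AQ = QA is the identity matrix. -/
open Matrix

/-- A real square matrix is doubly stochastic if it has nonnegative entries and
every row and every column sums to 1. -/
def IsDoublyStochastic {n : ℕ} (Q : Matrix (Fin n) (Fin n) ℝ) : Prop :=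
  (∀ i j, 0 ≤ Q i j) ∧ (∀ i, ∑ j, Q i j = 1) ∧ (∀ j, ∑ i, Q i j = 1)

open Finset in
theorem aux_count {n : ℕ} (G : SimpleGraph (Fin n)) [Fintype G.ConnectedComponent]
    [DecidableEq G.ConnectedComponent]
    (M : Finset (Fin n)) (hM : ∀ i, i ∉ M → ∃ j, G.Adj i j ∧ j ∉ M) :
    2 * Fintype.card G.ConnectedComponent ≤ n + M.card := by
  have h1 : ∀ c : G.ConnectedComponent,
      2 ≤ ∑ v ∈ univ.filter (fun v => G.connectedComponentMk v = c),
        (1 + if v ∈ M then 1 else 0) := by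
    intro c
    induction c using SimpleGraph.ConnectedComponent.ind with
    | h v =>
    by_cases hv : v ∈ M
    · have := Finset.single_le_sum (f := fun v => 1 + if v ∈ M then 1 else 0)
        (s := univ.filter (fun w => G.connectedComponentMk w = G.connectedComponentMk v))
        (fun _ _ => Nat.zero_le _) (a := v) (by simp)
      simpa [hv] using this
    · obtain ⟨j, hj, hjM⟩ := hM v hv
      have hsub : ({v, j} : Finset (Fin n)) ⊆
          univ.filter (fun w => G.connectedComponentMk w = G.connectedComponentMk v) := by
        intro w hw
        simp only [mem_insert, mem_singleton] at hw
        rcases hw with rfl | rfl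
        · simp
        · simp only [mem_filter, mem_univ, true_and]
          exact (SimpleGraph.ConnectedComponent.sound hj.reachable).symm
      refine le_trans ?_ (Finset.sum_le_sum_of_subset hsub)
      rw [Finset.sum_pair hj.ne]
      simp [hv, hjM]
  have h2 := Finset.sum_fiberwise (univ : Finset (Fin n)) (fun v => G.connectedComponentMk v)
    (fun v => (1 + if v ∈ M then 1 else 0))
  have h3 : ∑ v : Fin n, (1 + if v ∈ M then 1 else 0) = n + M.card := by
    simp [Finset.sum_add_distrib]
  rw [← h3, ← h2]
  calc 2 * Fintype.card G.ConnectedComponent = ∑ _c : G.ConnectedComponent, 2 := by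
        simp [mul_comm]
    _ ≤ _ := Finset.sum_le_sum (fun c _ => h1 c)

theorem aux_const {n : ℕ} (Q : Matrix (Fin n) (Fin n) ℝ) (hQ : IsDoublyStochastic Q)
    (x : Fin n → ℝ) (hx : Q.mulVec x = x) (i j : Fin n) (hij : Q i j ≠ 0) : x i = x j := by
  obtain ⟨h0, hr, hc⟩ := hQ
  have hs : ∑ a, ∑ b, Q a b * (x a - x b) ^ 2 = 0 := by
    have e1 : ∑ a, ∑ b, Q a b * x a ^ 2 = ∑ a, x a ^ 2 := by
      refine Finset.sum_congr rfl fun a _ => ?_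
      rw [← Finset.sum_mul, hr, one_mul]
    have e2 : ∑ a, ∑ b, Q a b * x b ^ 2 = ∑ a, x a ^ 2 := by
      rw [Finset.sum_comm]
      refine Finset.sum_congr rfl fun a _ => ?_
      rw [← Finset.sum_mul, hc, one_mul]
    have e3 : ∑ a, ∑ b, x a * (Q a b * x b) = ∑ a, x a ^ 2 := by
      refine Finset.sum_congr rfl fun a _ => ?_
      rw [← Finset.mul_sum]
      have : ∑ b, Q a b * x b = x a := congrFun hx a
      rw [this, sq]
    have e4 : ∀ a b, Q a b * (x a - x b) ^ 2
        = Q a b * x a ^ 2 + Q a b * x b ^ 2 - 2 * (x a * (Q a b * x b)) := by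
      intro a b; ring
    simp only [e4, Finset.sum_sub_distrib, Finset.sum_add_distrib, ← Finset.mul_sum] at *
    rw [e1, e2, e3]; ring
  have nn : ∀ a b, 0 ≤ Q a b * (x a - x b) ^ 2 := fun a b => mul_nonneg (h0 a b) (sq_nonneg _)
  have h1 := (Finset.sum_eq_zero_iff_of_nonneg
    (fun a _ => Finset.sum_nonneg fun b _ => nn a b)).1 hs i (Finset.mem_univ i)
  have h2 := (Finset.sum_eq_zero_iff_of_nonneg (fun b _ => nn i b)).1 h1 j (Finset.mem_univ j)
  rcases mul_eq_zero.1 h2 with h | h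
  · exact absurd h hij
  · exact sub_eq_zero.1 (pow_eq_zero_iff (two_ne_zero) |>.1 h)

/-- Theorem 1 (commutation form): if the symmetric matrix `A` has simple spectrum
(orthonormal eigenbasis `u` with injective eigenvalues `μ`), exactly `k` of the
eigenvectors are orthogonal to the all-ones vector, and each of those `k`
eigenvectors has at least `2k+1` nonzero entries, then the only doubly
stochastic matrix commuting with `A` is the identity. -/
theorem stmt_0 {n k : ℕ} (A : Matrix (Fin n) (Fin n) ℝ) (hA : A.IsSymm)
    (μ : Fin n → ℝ) (u : Fin n → (Fin n → ℝ))
    (hμ : Function.Injective μ)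
    (heig : ∀ i, A.mulVec (u i) = μ i • u i)
    (horth : ∀ i j, u i ⬝ᵥ u j = if i = j then (1 : ℝ) else 0)
    (S : Finset (Fin n))
    (hS : ∀ i, i ∈ S ↔ u i ⬝ᵥ (1 : Fin n → ℝ) = 0)
    (hcard : S.card = k)
    (hsupp : ∀ i ∈ S, 2 * k + 1 ≤ {j | u i j ≠ 0}.ncard)
    (Q : Matrix (Fin n) (Fin n) ℝ) (hQ : IsDoublyStochastic Q)
    (hcomm : A * Q = Q * A) : Q = 1 := by
  classical
  have hU : (Matrix.of u) * (Matrix.of u)ᵀ = 1 := by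
    ext i j
    rw [Matrix.one_apply, ← horth i j]
    rfl
  have hU2 : (Matrix.of u)ᵀ * (Matrix.of u) = 1 := mul_eq_one_comm.1 hU
  have hzero : ∀ x : Fin n → ℝ, (∀ j, u j ⬝ᵥ x = 0) → x = 0 := by
    intro x hx
    have h : (Matrix.of u).mulVec x = 0 := by
      ext j; exact hx j
    have := congrArg ((Matrix.of u)ᵀ.mulVec) h
    simpa [Matrix.mulVec_mulVec, hU2] using this
  have hlam : ∀ i, Q.mulVec (u i) = (u i ⬝ᵥ Q.mulVec (u i)) • u i := by
    intro i
    rw [← sub_eq_zero]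
    apply hzero
    intro j
    rw [dotProduct_sub, dotProduct_smul, horth]
    by_cases hji : j = i
    · subst hji; simp
    · have e1 : A.mulVec (Q.mulVec (u i)) = μ i • Q.mulVec (u i) := by
        rw [Matrix.mulVec_mulVec, hcomm, ← Matrix.mulVec_mulVec, heig, Matrix.mulVec_smul]
      have e2 : u j ⬝ᵥ A.mulVec (Q.mulVec (u i)) = μ j * (u j ⬝ᵥ Q.mulVec (u i)) := by
        rw [Matrix.dotProduct_mulVec, ← Matrix.mulVec_transpose, hA.eq, heig, smul_dotProduct,
          smul_eq_mul]
      rw [e1, dotProduct_smul, smul_eq_mul] at e2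
      have e3 : (μ i - μ j) * (u j ⬝ᵥ Q.mulVec (u i)) = 0 := by linarith
      rcases mul_eq_zero.1 e3 with h | h
      · exact absurd (hμ (sub_eq_zero.1 h)).symm hji
      · simp [h, hji]
  have hfix : ∀ i, i ∉ S → Q.mulVec (u i) = u i := by
    intro i hi
    have hne : u i ⬝ᵥ (1 : Fin n → ℝ) ≠ 0 := fun h => hi ((hS i).2 h)
    have e1 : (1 : Fin n → ℝ) ⬝ᵥ Q.mulVec (u i) = u i ⬝ᵥ (1 : Fin n → ℝ) := by
      rw [Matrix.dotProduct_mulVec, dotProduct_comm]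
      congr 1
      ext j
      simpa [Matrix.vecMul, dotProduct] using hQ.2.2 j
    rw [hlam i, dotProduct_smul, smul_eq_mul, dotProduct_comm 1 (u i)] at e1
    have e2 : u i ⬝ᵥ Q.mulVec (u i) = 1 := by
      apply mul_right_cancel₀ hne; rw [e1, one_mul]
    rw [hlam i, e2, one_smul]
  by_cases hall : ∀ i, Q.mulVec (u i) = u i
  · have h1 : Q * (Matrix.of u)ᵀ = (Matrix.of u)ᵀ := by
      ext a i
      exact congrFun (hall i) a
    calc Q = Q * ((Matrix.of u)ᵀ * Matrix.of u) := by rw [hU2, mul_one]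
      _ = 1 := by rw [← mul_assoc, h1, hU2]
  exfalso
  push Not at hall
  obtain ⟨i, hi⟩ := hall
  have hiS : i ∈ S := by
    by_contra h; exact hi (hfix i h)
  let G : SimpleGraph (Fin n) := SimpleGraph.fromRel (fun a b => Q a b ≠ 0)
  let M : Finset (Fin n) := Finset.univ.filter (fun a => ∀ b, ¬ G.Adj a b)
  have hcount := aux_count G M (by
    intro a ha
    simp only [M, Finset.mem_filter, Finset.mem_univ, true_and, not_forall, not_not] at ha ⊢
    obtain ⟨b, hb⟩ := ha
    exact ⟨b, hb, a, hb.symm⟩)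
  have hsub : {j | u i j ≠ 0} ⊆ ((Mᶜ : Finset (Fin n)) : Set (Fin n)) := by
    intro a ha
    rw [Finset.mem_coe, Finset.mem_compl]
    intro haM
    simp only [M, Finset.mem_filter, Finset.mem_univ, true_and] at haM
    apply hi
    have hoff : ∀ b, b ≠ a → Q a b = 0 := by
      intro b hb
      by_contra h
      exact haM b ((SimpleGraph.fromRel_adj _ _ _).2 ⟨hb.symm, Or.inl h⟩)
    have hd : Q a a = 1 := by
      rw [← hQ.2.1 a]
      exact (Finset.sum_eq_single a (fun b _ hb => hoff b hb) (by simp)).symm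
    have e1 : Q.mulVec (u i) a = u i a := by
      have : ∑ b, Q a b * u i b = Q a a * u i a :=
        Finset.sum_eq_single a (fun b _ hb => by rw [hoff b hb, zero_mul]) (by simp)
      rw [hd, one_mul] at this
      exact this
    rw [hlam i] at e1 ⊢
    simp only [Pi.smul_apply, smul_eq_mul] at e1
    have e2 : u i ⬝ᵥ Q.mulVec (u i) = 1 := by
      apply mul_right_cancel₀ (ha : u i a ≠ 0); rw [e1, one_mul]
    rw [e2, one_smul]
  have hm : 2 * k + 1 ≤ (Mᶜ).card := by
    refine (hsupp i hiS).trans ?_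
    rw [← Set.ncard_coe_finset]
    exact Set.ncard_le_ncard hsub (Finset.finite_toSet _)
  have hcompl := Finset.card_add_card_compl M
  have hcomplS := Finset.card_add_card_compl S
  rw [Fintype.card_fin] at hcompl hcomplS
  have hker : ∀ x : Fin n → ℝ, Q.mulVec x = x →
      x ∈ LinearMap.ker (Matrix.toLin' (G.lapMatrix ℝ)) := by
    intro x hx
    rw [LinearMap.mem_ker, Matrix.toLin'_apply,
      SimpleGraph.lapMatrix_mulVec_eq_zero_iff_forall_adj]
    intro a b hab
    rcases ((SimpleGraph.fromRel_adj _ _ _).1 hab).2 with h | h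
    · exact aux_const Q hQ x hx a b h
    · exact (aux_const Q hQ x hx b a h).symm
  have hli : LinearIndependent ℝ u := by
    rw [Fintype.linearIndependent_iff]
    intro g hg j
    have := congrArg (fun x => u j ⬝ᵥ x) hg
    simpa [dotProduct_sum, dotProduct_smul, horth] using this
  have hli2 : LinearIndependent ℝ (fun a : {a // a ∈ Sᶜ} =>
      (⟨u a, hker _ (hfix a (Finset.mem_compl.1 a.2))⟩ :
        LinearMap.ker (Matrix.toLin' (G.lapMatrix ℝ)))) := by
    apply LinearIndependent.of_comp (Submodule.subtype _)
    exact hli.comp (fun a : {a // a ∈ Sᶜ} => (a : Fin n)) Subtype.val_injective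
  have hle := hli2.fintype_card_le_finrank
  rw [Fintype.card_coe] at hle
  have hcc := SimpleGraph.card_connectedComponent_eq_finrank_ker_toLin'_lapMatrix G
  have hcc2 : Fintype.card G.ConnectedComponent
    = Module.finrank ℝ (LinearMap.ker (Matrix.toLin' (G.lapMatrix ℝ))) := by
    convert hcc
  omega
end

section
/- Let A be a real symmetric n×n matrix with n distinct eigenvalues, and suppose the eigenvectors (from an orthonormal eigenbasis) orthogonal to the all-ones vector 𝟏 are exactly u_1, …, u_k, sorted by their number of nonzero entries so that |u_1|₀ ≤ |u_2|₀ ≤ … ≤ |u_k|₀. If |u_i|₀ ≥ 2i+1 for every i = 1, …, k, then the only doubly stochastic matrix Q satisfying AQ = QA is the identity matrix. -/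
open Matrix

lemma exists_ore {α : Type*} [Fintype α] [DecidableEq α] (R : α → α → Prop)
    (hs : ∀ a b, R a b → R b a) (hi : ∀ a, ¬ R a a) (S : Finset α)
    (hS : ∀ a, a ∈ S ↔ ∃ b, R a b) :
    ∃ T : Finset α, S.card ≤ 2 * T.card ∧ ∀ t ∈ T, ∃ d, d ∉ T ∧ R t d := by
  classical
  let P : Finset α → Prop := fun D => D ⊆ S ∧ ∀ a ∈ S, a ∉ D → ∃ d ∈ D, R a d
  obtain ⟨D, hD, hmin⟩ := (Set.toFinite {D | P D}).exists_minimal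
    ⟨S, ⟨Finset.Subset.refl _, fun a h h' => absurd h h'⟩⟩
  have h2 : ∀ v ∈ D, ∃ d, d ∉ D ∧ R v d := by
    intro v hv
    by_contra hcon
    push Not at hcon
    have hP : P (D.erase v) := by
      refine ⟨(Finset.erase_subset _ _).trans hD.1, ?_⟩
      intro a ha hna
      by_cases hav : a = v
      · subst hav
        obtain ⟨b, hb⟩ := (hS a).1 ha
        refine ⟨b, Finset.mem_erase.2 ⟨?_, ?_⟩, hb⟩
        · rintro rfl; exact hi _ hb
        · by_contra hbD; exact hcon b hbD hb
      · have haD : a ∉ D := fun h => hna (Finset.mem_erase.2 ⟨hav, h⟩)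
        obtain ⟨d, hd, hR⟩ := hD.2 a ha haD
        refine ⟨d, Finset.mem_erase.2 ⟨?_, hd⟩, hR⟩
        rintro rfl
        exact hcon a haD (hs _ _ hR)
    have := hmin hP (Finset.erase_subset _ _)
    exact Finset.notMem_erase v D (this hv)
  have hc : (S \ D).card + D.card = S.card := Finset.card_sdiff_add_card_eq_card hD.1
  by_cases hle : D.card ≤ (S \ D).card
  · refine ⟨S \ D, by omega, ?_⟩
    intro t ht
    rw [Finset.mem_sdiff] at ht
    obtain ⟨d, hd, hR⟩ := hD.2 t ht.1 ht.2
    exact ⟨d, fun h => (Finset.mem_sdiff.1 h).2 hd, hR⟩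
  · exact ⟨D, by omega, h2⟩

open Classical in
lemma lap_card {n : ℕ} (L W : Matrix (Fin n) (Fin n) ℝ) (c : Fin n → ℝ)
    (hL : L = Wᵀ * diagonal c * W) (hsym : ∀ a b, L a b = L b a)
    (hoff : ∀ a b, a ≠ b → L a b ≤ 0) (hrow : ∀ a, ∑ b, L a b = 0) :
    (Finset.univ.filter fun a => ∃ b, a ≠ b ∧ L a b ≠ 0).card
      ≤ 2 * (Finset.univ.filter fun i => c i ≠ 0).card := by
  classical
  obtain ⟨T, hT, hdom⟩ := exists_ore (fun a b => a ≠ b ∧ L a b ≠ 0)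
    (fun a b h => ⟨h.1.symm, by rw [hsym]; exact h.2⟩) (fun a h => h.1 rfl)
    (Finset.univ.filter fun a => ∃ b, a ≠ b ∧ L a b ≠ 0) (by simp)
  refine hT.trans (Nat.mul_le_mul_left 2 ?_)
  let N : Matrix T T ℝ := L.submatrix Subtype.val Subtype.val
  have hdet : N.det ≠ 0 := by
    apply det_ne_zero_of_sum_row_lt_diag
    intro t
    obtain ⟨d, hdT, htd, hLd⟩ := hdom t.1 t.2
    have h1 : ∑ j ∈ Finset.univ.erase t, ‖N t j‖ = ∑ j ∈ T.erase t.1, - L t.1 j := by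
      have : ∑ j ∈ Finset.univ.erase t, ‖N t j‖ = ∑ j ∈ Finset.univ.erase t, - L t.1 j.1 := by
        apply Finset.sum_congr rfl
        intro j hj
        have hne : t.1 ≠ j.1 := fun h => (Finset.mem_erase.1 hj).1 (Subtype.ext h.symm)
        simp only [N, submatrix_apply, Real.norm_eq_abs]
        exact abs_of_nonpos (hoff _ _ hne)
      rw [this]
      have e1 := Finset.add_sum_erase (Finset.univ : Finset T) (fun j => - L t.1 j.1)
        (Finset.mem_univ t)
      have e2 := Finset.add_sum_erase T (fun j => - L t.1 j) t.2
      have e3 : ∑ j : T, - L t.1 j.1 = ∑ j ∈ T, - L t.1 j := by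
        exact Finset.sum_coe_sort T (fun j => - L t.1 j)
      linarith
    rw [h1]
    have h3 : L t.1 t.1 = ∑ j ∈ Finset.univ.erase t.1, - L t.1 j := by
      have := Finset.add_sum_erase Finset.univ (fun j => L t.1 j) (Finset.mem_univ t.1)
      rw [Finset.sum_neg_distrib]
      have h0 := hrow t.1
      linarith
    have h4 : ∑ j ∈ T.erase t.1, - L t.1 j < L t.1 t.1 := by
      rw [h3]
      apply Finset.sum_lt_sum_of_subset (i := d)
      · exact Finset.erase_subset_erase _ (Finset.subset_univ _)
      · exact Finset.mem_erase.2 ⟨htd.symm, Finset.mem_univ _⟩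
      · exact fun h => hdT (Finset.mem_of_mem_erase h)
      · have := lt_of_le_of_ne (hoff _ _ htd) hLd
        linarith
      · intro j hj _
        have := hoff t.1 j (Finset.ne_of_mem_erase hj).symm
        linarith
    exact h4.trans_le (le_abs_self _)
  have hrank : N.rank = T.card := by
    rw [rank_of_isUnit N ((isUnit_iff_isUnit_det N).2 (isUnit_iff_ne_zero.2 hdet))]
    simp
  have hN : N = (Wᵀ.submatrix (Subtype.val : T → Fin n) id) * diagonal c
      * (W.submatrix id (Subtype.val : T → Fin n)) := by
    ext a b
    simp [N, hL, Matrix.mul_apply]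
  calc T.card = N.rank := hrank.symm
    _ ≤ (diagonal c).rank := by
        rw [hN]
        exact (rank_mul_le_left _ _).trans (rank_mul_le_right _ _)
    _ = _ := by
        rw [rank_diagonal, Fintype.card_subtype]

/-- Theorem 2 (commutation form): `A` symmetric with simple spectrum
(orthonormal eigenbasis `w` with injective eigenvalues `μ`); the eigenvectors
orthogonal to the all-ones vector are exactly `w (e 1), …, w (e k)` (for an
injection `e : Fin k → Fin n`), sorted by number of nonzero entries, and the
`i`-th one (1-based) has at least `2i+1` nonzero entries. Then the only doubly
stochastic matrix commuting with `A` is the identity. -/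
theorem stmt_2 {n k : ℕ} (A : Matrix (Fin n) (Fin n) ℝ) (hA : A.IsSymm)
    (μ : Fin n → ℝ) (w : Fin n → (Fin n → ℝ))
    (hμ : Function.Injective μ)
    (heig : ∀ i, A.mulVec (w i) = μ i • w i)
    (horth : ∀ i j, w i ⬝ᵥ w j = if i = j then (1 : ℝ) else 0)
    (e : Fin k → Fin n) (he : Function.Injective e)
    (hrange : ∀ i : Fin n, w i ⬝ᵥ (1 : Fin n → ℝ) = 0 ↔ i ∈ Set.range e)
    (hsorted : ∀ i j : Fin k, i ≤ j →
      {l | w (e i) l ≠ 0}.ncard ≤ {l | w (e j) l ≠ 0}.ncard)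
    (hsupp : ∀ i : Fin k, 2 * ((i : ℕ) + 1) + 1 ≤ {l | w (e i) l ≠ 0}.ncard)
    (Q : Matrix (Fin n) (Fin n) ℝ) (hQ : IsDoublyStochastic Q)
    (hcomm : A * Q = Q * A) : Q = 1 := by
  classical
  obtain ⟨hpos, hrow, hcol⟩ := hQ
  let W : Matrix (Fin n) (Fin n) ℝ := Matrix.of w
  have hWW : W * Wᵀ = 1 := by
    ext i j
    have := horth i j
    simpa [W, Matrix.mul_apply, dotProduct, Matrix.one_apply] using this
  have hWW' : Wᵀ * W = 1 := mul_eq_one_comm.1 hWW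
  have hAW : A * Wᵀ = Wᵀ * diagonal μ := by
    ext a i
    have := congrFun (heig i) a
    rw [mul_diagonal]
    simp only [Matrix.mulVec, dotProduct, Pi.smul_apply, smul_eq_mul] at this
    simp only [Matrix.mul_apply, W, transpose_apply, of_apply]
    rw [this]; ring
  have hWA : W * A = diagonal μ * W := by
    have := congrArg transpose hAW
    simpa [transpose_mul, hA.eq] using this
  let M := W * Q * Wᵀ
  have hDM : diagonal μ * M = M * diagonal μ := by
    calc diagonal μ * M = (diagonal μ * W) * Q * Wᵀ := by simp only [M, Matrix.mul_assoc]
      _ = W * (A * Q) * Wᵀ := by rw [← hWA]; simp only [Matrix.mul_assoc]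
      _ = W * Q * (A * Wᵀ) := by rw [hcomm]; simp only [Matrix.mul_assoc]
      _ = M * diagonal μ := by rw [hAW]; simp only [M, Matrix.mul_assoc]
  have hMd : M = diagonal (fun i => M i i) := by
    ext i j
    by_cases hij : i = j
    · subst hij; simp
    · rw [diagonal_apply_ne _ hij]
      have := congrFun (congrFun hDM i) j
      rw [diagonal_mul, mul_diagonal] at this
      have h0 : (μ i - μ j) * M i j = 0 := by linarith
      rcases mul_eq_zero.1 h0 with h | h
      · exact absurd (hμ (sub_eq_zero.1 h)) hij
      · exact h
  let c : Fin n → ℝ := fun i => 1 - M i i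
  have hc : diagonal c = 1 - M := by
    rw [hMd, ← diagonal_one, diagonal_sub]
  have hL : (1 - Q) = Wᵀ * diagonal c * W := by
    rw [hc, Matrix.mul_sub, Matrix.sub_mul, Matrix.mul_one, hWW']
    congr 1
    calc Q = (Wᵀ * W) * Q * (Wᵀ * W) := by rw [hWW']; simp
      _ = _ := by simp only [M, Matrix.mul_assoc]
  set L := 1 - Q with hLdef
  have hWL : W * L = diagonal c * W := by
    rw [hL, ← Matrix.mul_assoc, ← Matrix.mul_assoc, hWW, Matrix.one_mul]
  have hLW : L * Wᵀ = Wᵀ * diagonal c := by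
    rw [hL, Matrix.mul_assoc, hWW, Matrix.mul_one]
  have hLrow : ∀ a, ∑ b, L a b = 0 := by
    intro a
    simp [hLdef, Matrix.sub_apply, Finset.sum_sub_distrib, hrow, Matrix.one_apply]
  have hLsym : ∀ a b, L a b = L b a := by
    have : Lᵀ = L := by
      rw [hL]; simp [transpose_mul, Matrix.mul_assoc]
    intro a b
    exact congrFun (congrFun this b) a
  have hoff : ∀ a b, a ≠ b → L a b ≤ 0 := by
    intro a b hab
    simp [hLdef, Matrix.one_apply_ne hab, hpos]
  have hcr : ∀ i, c i ≠ 0 → i ∈ Set.range e := by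
    intro i hi
    rw [← hrange]
    have h1 : L *ᵥ (1 : Fin n → ℝ) = 0 := by
      ext a; simpa [Matrix.mulVec, dotProduct] using hLrow a
    have h2 : (diagonal c * W) *ᵥ (1 : Fin n → ℝ) = 0 := by
      rw [← hWL, ← Matrix.mulVec_mulVec, h1, Matrix.mulVec_zero]
    have h3 := congrFun h2 i
    rw [← Matrix.mulVec_mulVec, Matrix.mulVec_diagonal] at h3
    exact (mul_eq_zero.1 h3).resolve_left hi
  have hcard := lap_card L W c hL hLsym hoff hLrow
  let I : Finset (Fin k) := Finset.univ.filter fun i => c (e i) ≠ 0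
  have hI : (Finset.univ.filter fun i => c i ≠ 0) = I.image e := by
    ext i
    simp only [Finset.mem_filter, Finset.mem_univ, true_and, Finset.mem_image, I]
    constructor
    · intro h
      obtain ⟨j, rfl⟩ := hcr i h
      exact ⟨j, h, rfl⟩
    · rintro ⟨j, h, rfl⟩; exact h
  rw [hI, Finset.card_image_of_injective _ he] at hcard
  rcases I.eq_empty_or_nonempty with hE | hne
  · have hc0 : c = 0 := by
      funext i
      by_contra h
      have : i ∈ (Finset.univ.filter fun i => c i ≠ 0) := by simpa using h
      rw [hI, hE] at this
      simp at this
    have hL0 : L = 0 := by rw [hL, hc0]; simp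
    exact (sub_eq_zero.1 hL0).symm
  · exfalso
    let j := I.max' hne
    have hj : c (e j) ≠ 0 := (Finset.mem_filter.1 (I.max'_mem hne)).2
    have hIc : I.card ≤ (j : ℕ) + 1 := by
      have : I ⊆ Finset.Iic j := fun i hi => Finset.mem_Iic.2 (I.le_max' i hi)
      have := Finset.card_le_card this
      simpa using this
    have hsub : {l | w (e j) l ≠ 0} ⊆
        ((Finset.univ.filter fun a => ∃ b, a ≠ b ∧ L a b ≠ 0 : Finset (Fin n)) : Set (Fin n)) := by
      intro l hl
      by_contra hcon
      have hz : ∀ b, l ≠ b → L l b = 0 := by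
        intro b hb
        by_contra h
        exact hcon (by simpa using ⟨b, hb, h⟩)
      have hz' : ∀ b, L l b = 0 := by
        intro b
        by_cases hb : l = b
        · subst hb
          have := hLrow l
          rwa [Finset.sum_eq_single l (fun b _ hb => hz b hb.symm) (by simp)] at this
        · exact hz b hb
      have h5 := congrFun (congrFun hLW l) (e j)
      rw [mul_diagonal, Matrix.mul_apply] at h5
      simp only [hz', zero_mul, Finset.sum_const_zero] at h5
      rcases mul_eq_zero.1 h5.symm with h | h
      · exact hl h
      · exact hj h
    have h6 := Set.ncard_le_ncard hsub (Set.toFinite _)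
    rw [Set.ncard_coe_finset] at h6
    have := hsupp j
    omega
end

section
/- Let A be a real symmetric n×n matrix with n distinct eigenvalues, and suppose the eigenvectors (from an orthonormal eigenbasis) orthogonal to the all-ones vector 𝟏 are exactly u_1, …, u_k, sorted by number of nonzero entries so that |u_1|₀ ≤ … ≤ |u_k|₀, and satisfying |u_i|₀ ≥ 2i+1 for every i. Then the only permutation matrix P satisfying AP = PA is the identity matrix; that is, if A is the adjacency matrix of a graph, the automorphism group of that graph is trivial. -/
open Matrix

/-- A permutation matrix is the matrix of a permutation: a 0/1 matrix with
exactly one 1 in each row and column. -/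
def IsPermMatrix {n : ℕ} (P : Matrix (Fin n) (Fin n) ℝ) : Prop :=
  ∃ σ : Equiv.Perm (Fin n), P = σ.permMatrix ℝ

/-- Corollary 1: `A` symmetric with simple spectrum; the eigenvectors orthogonal
to the all-ones vector are exactly `w (e 1), …, w (e k)`, sorted by number of
nonzero entries, the `i`-th (1-based) having at least `2i+1` nonzero entries.
Then the only permutation matrix commuting with `A` is the identity: the
automorphism group of the corresponding graph is trivial. -/
theorem stmt_4 {n k : ℕ} (A : Matrix (Fin n) (Fin n) ℝ) (hA : A.IsSymm)
    (μ : Fin n → ℝ) (w : Fin n → (Fin n → ℝ))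
    (hμ : Function.Injective μ)
    (heig : ∀ i, A.mulVec (w i) = μ i • w i)
    (horth : ∀ i j, w i ⬝ᵥ w j = if i = j then (1 : ℝ) else 0)
    (e : Fin k → Fin n) (he : Function.Injective e)
    (hrange : ∀ i : Fin n, w i ⬝ᵥ (1 : Fin n → ℝ) = 0 ↔ i ∈ Set.range e)
    (hsorted : ∀ i j : Fin k, i ≤ j →
      {l | w (e i) l ≠ 0}.ncard ≤ {l | w (e j) l ≠ 0}.ncard)
    (hsupp : ∀ i : Fin k, 2 * ((i : ℕ) + 1) + 1 ≤ {l | w (e i) l ≠ 0}.ncard)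
    (P : Matrix (Fin n) (Fin n) ℝ) (hP : IsPermMatrix P)
    (hcomm : A * P = P * A) : P = 1 := by
  obtain ⟨σ, rfl⟩ := hP
  set P : Matrix (Fin n) (Fin n) ℝ := σ.permMatrix ℝ with hPdef
  have hPv : ∀ (v : Fin n → ℝ) l, (P *ᵥ v) l = v (σ l) := by
    intro v l
    rw [hPdef, Matrix.permMatrix_mulVec]
    rfl
  let W : Matrix (Fin n) (Fin n) ℝ := Matrix.of w
  have hW : W * Wᵀ = 1 := by
    ext i j
    rw [Matrix.mul_apply, Matrix.one_apply, ← horth i j]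
    rfl
  have hW' : Wᵀ * W = 1 := mul_eq_one_comm.mp hW
  let c : Fin n → ℝ := fun i => w i ⬝ᵥ (P *ᵥ w i)
  have hoff : ∀ i j, j ≠ i → w j ⬝ᵥ (P *ᵥ w i) = 0 := by
    intro i j hij
    have h1 : A *ᵥ (P *ᵥ w i) = μ i • (P *ᵥ w i) := by
      rw [Matrix.mulVec_mulVec, hcomm, ← Matrix.mulVec_mulVec, heig, Matrix.mulVec_smul]
    have h2 : w j ⬝ᵥ (A *ᵥ (P *ᵥ w i)) = (A *ᵥ w j) ⬝ᵥ (P *ᵥ w i) := by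
      rw [Matrix.dotProduct_mulVec, ← Matrix.mulVec_transpose, hA.eq]
    rw [h1, heig, dotProduct_smul, smul_dotProduct, smul_eq_mul, smul_eq_mul] at h2
    have h3 : (μ i - μ j) * (w j ⬝ᵥ (P *ᵥ w i)) = 0 := by linarith
    rcases mul_eq_zero.mp h3 with h | h
    · exact absurd (hμ (sub_eq_zero.mp h)).symm hij
    · exact h
  have hc : ∀ i, P *ᵥ w i = c i • w i := by
    intro i
    have h1 : P *ᵥ w i = Wᵀ *ᵥ (W *ᵥ (P *ᵥ w i)) := by
      rw [Matrix.mulVec_mulVec (P *ᵥ w i) Wᵀ W, hW', Matrix.one_mulVec]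
    have h2 : W *ᵥ (P *ᵥ w i) = Pi.single i (c i) := by
      ext j
      by_cases h : j = i
      · subst h
        rw [Pi.single_eq_same]
        rfl
      · rw [Pi.single_eq_of_ne h]
        exact hoff i j h
    rw [h1, h2]
    ext l
    simp [W, mul_comm]
  have hcsq : ∀ i, c i = 1 ∨ c i = -1 := by
    intro i
    have h1 : (P *ᵥ w i) ⬝ᵥ (P *ᵥ w i) = w i ⬝ᵥ w i := by
      simp only [dotProduct, hPv]
      exact Equiv.sum_comp σ (fun l => w i l * w i l)
    rw [hc i, dotProduct_smul, smul_dotProduct, horth] at h1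
    simp only [if_true, smul_eq_mul, mul_one] at h1
    exact mul_self_eq_one_iff.mp h1
  have hcone : ∀ i, c i = -1 → i ∈ Set.range e := by
    intro i hi
    rw [← hrange]
    have h1 : (P *ᵥ w i) ⬝ᵥ (1 : Fin n → ℝ) = w i ⬝ᵥ 1 := by
      simp only [dotProduct, hPv, Pi.one_apply, mul_one]
      exact Equiv.sum_comp σ (fun l => w i l)
    rw [hc i, hi, smul_dotProduct, smul_eq_mul] at h1
    linarith
  let M : Finset (Fin n) := Finset.univ.filter (fun l => σ l ≠ l)
  let S : Finset (Fin n) := Finset.univ.filter (fun i => c i = -1)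
  let T : Finset (Fin k) := Finset.univ.filter (fun i => c (e i) = -1)
  have hST : S.card = T.card := by
    rw [← Finset.card_image_of_injective T he]
    congr 1
    ext i
    simp only [S, T, Finset.mem_filter, Finset.mem_univ, true_and, Finset.mem_image]
    constructor
    · intro h
      obtain ⟨j, rfl⟩ := hcone i h
      exact ⟨j, h, rfl⟩
    · rintro ⟨j, h, rfl⟩
      exact h
  have htr : ∑ i, c i = ∑ l, P l l := by
    have h1 : Matrix.trace (W * (P * Wᵀ)) = Matrix.trace P := by
      rw [Matrix.trace_mul_comm, Matrix.mul_assoc, hW', Matrix.mul_one]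
    exact h1
  have htr1 : ∑ i, c i = n - 2 * (S.card : ℝ) := by
    have : ∀ i, c i = 1 - 2 * (if c i = -1 then (1 : ℝ) else 0) := by
      intro i
      rcases hcsq i with h | h <;> rw [h] <;> norm_num
    rw [Finset.sum_congr rfl (fun i _ => this i), Finset.sum_sub_distrib, ← Finset.mul_sum,
      Finset.sum_boole]
    simp [S]
  have htr2 : ∑ l, P l l = n - (M.card : ℝ) := by
    have : ∀ l, P l l = 1 - (if σ l ≠ l then (1 : ℝ) else 0) := by
      intro l
      by_cases h : σ l = l <;>
      simp [hPdef, Equiv.Perm.permMatrix, PEquiv.toMatrix_apply, h]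
    rw [Finset.sum_congr rfl (fun i _ => this i), Finset.sum_sub_distrib, Finset.sum_boole]
    simp [M]
  have hcard : M.card = 2 * T.card := by
    rw [← hST]
    have : (M.card : ℝ) = 2 * S.card := by linarith
    exact_mod_cast this
  have hle : ∀ i ∈ T, 2 * ((i : ℕ) + 1) + 1 ≤ 2 * T.card := by
    intro i hi
    rw [← hcard]
    refine (hsupp i).trans ?_
    rw [← Set.ncard_coe_finset]
    refine Set.ncard_le_ncard ?_ (Finset.finite_toSet M)
    intro l hl
    simp only [M, Finset.coe_filter, Finset.mem_univ, true_and, Set.mem_ofPred_eq] at hl ⊢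
    intro hfix
    apply hl
    have h1 := congrFun (hc (e i)) l
    rw [hPv, hfix, (Finset.mem_filter.mp hi).2] at h1
    simp only [Pi.smul_apply, smul_eq_mul] at h1
    linarith
  have hT0 : T.card = 0 := by
    by_contra hne
    have h1 : T.card ≤ (Finset.range (T.card - 1)).card := by
      refine Finset.card_le_card_of_injOn (fun i => (i : ℕ)) ?_ (fun a _ b _ h => Fin.ext h)
      intro i hi
      have := hle i hi
      simp only [Finset.coe_range, Set.mem_Iio]
      omega
    rw [Finset.card_range] at h1
    omega
  have hM : M = ∅ := by
    rw [← Finset.card_eq_zero, hcard, hT0]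
  have hσ : σ = 1 := by
    ext l
    by_contra h
    have : l ∈ M := Finset.mem_filter.mpr ⟨Finset.mem_univ _, fun h' => h (by rw [h']; rfl)⟩
    rw [hM] at this
    simp at this
  rw [hPdef, hσ]
  simp
end

section
/- Let A be a real symmetric n×n matrix with n distinct eigenvalues. If P is an n×n permutation matrix such that AP = PA, then P² = I. -/
open Matrix

/-- Lemma: if the real symmetric matrix `A` has simple spectrum (an orthonormal
eigenbasis `u` with pairwise distinct eigenvalues `μ`) and `P` is a permutation
matrix commuting with `A`, then `P² = I`. -/
theorem stmt_5 {n : ℕ} (A : Matrix (Fin n) (Fin n) ℝ) (hA : A.IsSymm)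
    (μ : Fin n → ℝ) (u : Fin n → (Fin n → ℝ))
    (hμ : Function.Injective μ)
    (heig : ∀ i, A.mulVec (u i) = μ i • u i)
    (horth : ∀ i j, u i ⬝ᵥ u j = if i = j then (1 : ℝ) else 0)
    (P : Matrix (Fin n) (Fin n) ℝ) (hP : IsPermMatrix P)
    (hcomm : A * P = P * A) : P * P = 1 := by
  have hUU : Matrix.of u * (Matrix.of u)ᵀ = 1 := by
    ext i j
    have := horth i j
    simpa [Matrix.mul_apply, dotProduct, Matrix.one_apply] using this
  have hUU' : (Matrix.of u)ᵀ * Matrix.of u = 1 := mul_eq_one_comm.mp hUU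
  have hAU : A * (Matrix.of u)ᵀ = (Matrix.of u)ᵀ * diagonal μ := by
    ext i j
    have := congrFun (heig j) i
    rw [Matrix.mul_diagonal, Matrix.mul_apply]
    simpa [Matrix.mulVec, dotProduct, mul_comm] using this
  have hUA : Matrix.of u * A = diagonal μ * Matrix.of u := by
    have := congrArg Matrix.transpose hAU
    simpa [Matrix.transpose_mul, hA.eq] using this
  generalize Matrix.of u = U at *
  have hDQ : diagonal μ * (U * P * Uᵀ) = (U * P * Uᵀ) * diagonal μ := by
    calc diagonal μ * (U * P * Uᵀ) = (diagonal μ * U) * P * Uᵀ := by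
          simp only [Matrix.mul_assoc]
      _ = U * (A * P) * Uᵀ := by rw [← hUA]; simp only [Matrix.mul_assoc]
      _ = U * P * (A * Uᵀ) := by rw [hcomm]; simp only [Matrix.mul_assoc]
      _ = _ := by rw [hAU]; simp only [Matrix.mul_assoc]
  have hQ : (U * P * Uᵀ)ᵀ = U * P * Uᵀ := by
    generalize U * P * Uᵀ = Q at *
    have hz : ∀ i j, i ≠ j → Q i j = 0 := by
      intro i j hij
      have h := congrFun (congrFun hDQ i) j
      rw [Matrix.mul_diagonal, Matrix.diagonal_mul] at h
      have h2 : (μ i - μ j) * Q i j = 0 := by linarith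
      exact (mul_eq_zero.mp h2).resolve_left (sub_ne_zero.mpr (hμ.ne hij))
    ext i j
    by_cases hij : i = j
    · subst hij; rfl
    · rw [Matrix.transpose_apply, hz i j hij, hz j i (Ne.symm hij)]
  have hPQ : P = Uᵀ * (U * P * Uᵀ) * U := by
    calc P = (Uᵀ * U) * P * (Uᵀ * U) := by rw [hUU']; simp
      _ = _ := by simp only [Matrix.mul_assoc]
  have hPt : Pᵀ = P := by
    have h := congrArg Matrix.transpose hPQ
    rw [Matrix.transpose_mul, Matrix.transpose_mul, hQ, Matrix.transpose_transpose,
      ← Matrix.mul_assoc, ← hPQ] at h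
    exact h
  obtain ⟨σ, rfl⟩ := hP
  have h1 : σ.permMatrix ℝ * (σ.permMatrix ℝ)ᵀ = 1 := by
    rw [Matrix.transpose_permMatrix, ← Matrix.permMatrix_mul]
    simp
  rwa [hPt] at h1
end

section
/- Let A be a real symmetric n×n matrix with n distinct eigenvalues, and suppose there exists a permutation matrix P ≠ I with AP = PA (i.e., the automorphism group of the corresponding graph is nontrivial). Then there exist an integer k ≥ 1 and k pairwise orthogonal unit eigenvectors u_1, …, u_k of A, each satisfying u_iᵀ𝟏 = 0, and each having at most 2k nonzero entries; moreover each of these eigenvectors has an even number of nonzero entries. -/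
open Matrix

/-- Proposition 1: if the real symmetric matrix `A` has simple spectrum and the
automorphism group of the corresponding graph is nontrivial (there is a
permutation matrix `P ≠ I` commuting with `A`), then there exist `k ≥ 1`
pairwise orthogonal unit eigenvectors of `A`, each orthogonal to the all-ones
vector and each with at most `2k` nonzero entries; moreover each of them has an
even number of nonzero entries. -/
theorem stmt_7 {n : ℕ} (A : Matrix (Fin n) (Fin n) ℝ) (hA : A.IsSymm)
    (μ : Fin n → ℝ) (w : Fin n → (Fin n → ℝ))
    (hμ : Function.Injective μ)
    (heig : ∀ i, A.mulVec (w i) = μ i • w i)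
    (horth : ∀ i j, w i ⬝ᵥ w j = if i = j then (1 : ℝ) else 0)
    (P : Matrix (Fin n) (Fin n) ℝ) (hP : IsPermMatrix P)
    (hPne : P ≠ 1) (hcomm : A * P = P * A) :
    ∃ (k : ℕ) (u : Fin k → (Fin n → ℝ)), 1 ≤ k ∧
      (∀ i, ∃ lam : ℝ, A.mulVec (u i) = lam • u i) ∧
      (∀ i, u i ⬝ᵥ u i = 1) ∧
      (∀ i j, i ≠ j → u i ⬝ᵥ u j = 0) ∧
      (∀ i, u i ⬝ᵥ (1 : Fin n → ℝ) = 0) ∧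
      (∀ i, {l | u i l ≠ 0}.ncard ≤ 2 * k) ∧
      (∀ i, Even {l | u i l ≠ 0}.ncard) := by
  classical
  obtain ⟨σ, rfl⟩ := hP
  have hPv : ∀ v : Fin n → ℝ, (σ.permMatrix ℝ) *ᵥ v = v ∘ σ := fun v => by
    rw [Matrix.permMatrix_mulVec]
  set W : Matrix (Fin n) (Fin n) ℝ := Matrix.of w with hW
  have hWW : W * Wᵀ = 1 := by
    ext i j
    rw [Matrix.mul_apply, Matrix.one_apply, ← horth i j]
    rfl
  have hWW' : Wᵀ * W = 1 := mul_eq_one_comm.mp hWW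
  have hcol : ∀ a b : Fin n, (∀ i, w i a = w i b) → a = b := by
    intro a b h
    by_contra hne
    have h1 : (Wᵀ * W) a b = (Wᵀ * W) a a := by
      simp only [Matrix.mul_apply, Matrix.transpose_apply, hW, Matrix.of_apply, h]
    rw [hWW', Matrix.one_apply_ne hne, Matrix.one_apply_eq] at h1
    exact zero_ne_one h1
  have hAW : A * Wᵀ = Wᵀ * Matrix.diagonal μ := by
    ext i j
    have := congrFun (heig j) i
    rw [Matrix.mul_diagonal, Matrix.mul_apply]
    simp only [Matrix.mulVec, dotProduct, Pi.smul_apply, smul_eq_mul] at this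
    simp only [Matrix.transpose_apply, hW, Matrix.of_apply]
    rw [this, mul_comm]
  have hWA : W * A = Matrix.diagonal μ * W := by
    have := congrArg Matrix.transpose hAW
    simpa [Matrix.transpose_mul, hA.eq] using this
  set P := σ.permMatrix ℝ with hPdef
  set M := W * P * Wᵀ with hM
  have hMD : M * Matrix.diagonal μ = Matrix.diagonal μ * M := by
    calc M * Matrix.diagonal μ = W * P * (Wᵀ * Matrix.diagonal μ) := by
          rw [hM, Matrix.mul_assoc]
      _ = W * (P * A) * Wᵀ := by rw [← hAW]; simp only [Matrix.mul_assoc]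
      _ = (W * A) * P * Wᵀ := by rw [← hcomm]; simp only [Matrix.mul_assoc]
      _ = Matrix.diagonal μ * M := by rw [hWA, hM]; simp only [Matrix.mul_assoc]
  have hMdiag : ∀ i j, i ≠ j → M i j = 0 := by
    intro i j hij
    have h1 := congrFun (congrFun hMD i) j
    rw [Matrix.mul_diagonal, Matrix.diagonal_mul] at h1
    have h2 : M i j * (μ j - μ i) = 0 := by linarith
    rcases mul_eq_zero.mp h2 with h | h
    · exact h
    · exact absurd (hμ (sub_eq_zero.mp h)).symm hij
  have hPW : P * Wᵀ = Wᵀ * M := by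
    rw [hM, ← Matrix.mul_assoc, ← Matrix.mul_assoc, hWW', Matrix.one_mul]
  set ε : Fin n → ℝ := fun i => M i i with hε
  have hσ : ∀ i l, w i (σ l) = ε i * w i l := by
    intro i l
    have h1 := congrFun (congrFun hPW l) i
    have h2 : (P * Wᵀ) l i = (P *ᵥ w i) l := rfl
    rw [h2, hPv, Matrix.mul_apply, Finset.sum_eq_single i] at h1
    · simpa [hW, hε, mul_comm] using h1
    · intro b _ hb
      rw [hMdiag b i hb, mul_zero]
    · simp
  have hε2 : ∀ i, ε i * ε i = 1 := by
    intro i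
    have h1 : w i ⬝ᵥ w i = 1 := by simpa using horth i i
    have h2 : ∑ l, w i (σ l) * w i (σ l) = ∑ l, w i l * w i l :=
      Equiv.sum_comp σ (fun l => w i l * w i l)
    have h3 : ∑ l, w i (σ l) * w i (σ l) = ε i * ε i * ∑ l, w i l * w i l := by
      rw [Finset.mul_sum]
      refine Finset.sum_congr rfl fun l _ => ?_
      rw [hσ]; ring
    have h4 : ∑ l, w i l * w i l = 1 := h1
    rw [h2, h4] at h3
    linarith
  have hσσ : ∀ l, σ (σ l) = l := by
    intro l
    refine hcol _ _ fun i => ?_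
    rw [hσ, hσ, ← mul_assoc, hε2, one_mul]
  have hεpm : ∀ i, ε i = 1 ∨ ε i = -1 := fun i => mul_self_eq_one_iff.mp (hε2 i)
  set S : Finset (Fin n) := Finset.univ.filter fun i => ε i = -1 with hS
  set T : Finset (Fin n) := Finset.univ.filter fun l => σ l ≠ l with hT
  have htr : M.trace = P.trace := by
    rw [hM, Matrix.trace_mul_comm, ← Matrix.mul_assoc, hWW', Matrix.one_mul]
  have htM : M.trace = n - 2 * (S.card : ℝ) := by
    have h1 : ∀ i, M i i = 1 - 2 * (if ε i = -1 then (1 : ℝ) else 0) := by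
      intro i
      change ε i = _
      rcases hεpm i with h | h
      · rw [h]; norm_num
      · rw [h]; norm_num
    simp only [Matrix.trace, Matrix.diag_apply, h1]
    rw [Finset.sum_sub_distrib, ← Finset.mul_sum, Finset.sum_boole]
    simp [hS]
  have htP : P.trace = n - (T.card : ℝ) := by
    have h1 : ∀ l, P l l = 1 - (if σ l ≠ l then (1 : ℝ) else 0) := by
      intro l
      simp only [hPdef, Equiv.Perm.permMatrix, Equiv.toPEquiv, PEquiv.toMatrix_apply]
      by_cases h : σ l = l <;> simp [h]
    simp only [Matrix.trace, Matrix.diag_apply, h1]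
    rw [Finset.sum_sub_distrib, Finset.sum_boole]
    simp [hT]
  have hcard : T.card = 2 * S.card := by
    have : (T.card : ℝ) = 2 * (S.card : ℝ) := by linarith
    exact_mod_cast this
  have hneg : ∀ i : Fin S.card, ∀ l,
      w (S.equivFin.symm i) (σ l) = - w (S.equivFin.symm i) l := by
    intro i l
    have := (Finset.mem_filter.mp (S.equivFin.symm i).2).2
    rw [hσ, this]; ring
  have hfix : ∀ i : Fin S.card, ∀ l,
      w (S.equivFin.symm i) l ≠ 0 → σ l ≠ l := by
    intro i l hl h
    have := hneg i l
    rw [h] at this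
    exact hl (by linarith)
  have hsupp : ∀ i : Fin S.card, {l | w (S.equivFin.symm i) l ≠ 0} =
      ((Finset.univ.filter fun l => w (S.equivFin.symm i) l ≠ 0 : Finset (Fin n)) :
        Set (Fin n)) := by
    intro i; ext l; simp
  refine ⟨S.card, fun i => w (S.equivFin.symm i), ?_, fun i => ⟨_, heig _⟩, ?_, ?_, ?_, ?_, ?_⟩
  · by_contra h
    have hS0 : S.card = 0 := by omega
    rw [hS0, mul_zero, Finset.card_eq_zero, hT, Finset.filter_eq_empty_iff] at hcard
    apply hPne
    have : σ = 1 := by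
      ext l
      have := hcard (Finset.mem_univ l)
      rw [not_not] at this
      simp [this]
    rw [hPdef, this]
    simp
  · intro i
    simpa using horth (S.equivFin.symm i) (S.equivFin.symm i)
  · intro i j hij
    rw [horth, if_neg]
    intro h
    exact hij (S.equivFin.symm.injective (Subtype.ext h))
  · intro i
    have h1 : ∑ l, w (S.equivFin.symm i) (σ l) = ∑ l, w (S.equivFin.symm i) l :=
      Equiv.sum_comp σ _
    simp only [hneg, Finset.sum_neg_distrib] at h1
    rw [dotProduct_one]
    linarith
  · intro i
    rw [hsupp, Set.ncard_coe_finset, ← hcard]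
    refine Finset.card_le_card fun l hl => ?_
    rw [Finset.mem_filter] at hl
    rw [hT, Finset.mem_filter]
    exact ⟨hl.1, hfix i l hl.2⟩
  · intro i
    rw [hsupp, Set.ncard_coe_finset, ← ZMod.natCast_eq_zero_iff_even, Finset.card_eq_sum_ones,
      Nat.cast_sum]
    refine Finset.sum_involution (fun l _ => σ l) ?_ ?_ ?_ ?_
    · intro l _
      decide
    · intro l hl _
      rw [Finset.mem_filter] at hl
      exact hfix i l hl.2
    · intro l hl
      rw [Finset.mem_filter] at hl ⊢
      exact ⟨Finset.mem_univ _, by rw [hneg]; exact neg_ne_zero.mpr hl.2⟩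
    · intro l _
      exact hσσ l
end

section
/- Let A be a real n×n matrix, P₀ an n×n permutation matrix, and B = P₀ A P₀ᵀ. If there exists a permutation matrix P ≠ I with AP = PA (i.e., the corresponding graph has a nontrivial automorphism), then there exists a doubly stochastic matrix Q that is not a permutation matrix and satisfies AQ = QB. In particular, triviality of the automorphism group is a necessary condition for the graph matching problem and its convex relaxation over doubly stochastic matrices to have the same unique solution. -/
open Matrix

/-- If the graph of `A` has a nontrivial automorphism (a permutation matrix
`P ≠ I` commuting with `A`), then with `B = P₀ A P₀ᵀ` the relaxed matching
problem `AQ = QB` admits a doubly stochastic solution that is not a permutation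
matrix: triviality of the automorphism group is necessary for the equivalence
of the graph matching problem and its convex relaxation. -/
theorem stmt_10 {n : ℕ} (A : Matrix (Fin n) (Fin n) ℝ)
    (P₀ : Matrix (Fin n) (Fin n) ℝ) (hP₀ : IsPermMatrix P₀)
    (B : Matrix (Fin n) (Fin n) ℝ) (hB : B = P₀ * A * P₀ᵀ)
    (P : Matrix (Fin n) (Fin n) ℝ) (hP : IsPermMatrix P)
    (hPne : P ≠ 1) (hcomm : A * P = P * A) :
    ∃ Q : Matrix (Fin n) (Fin n) ℝ,
      IsDoublyStochastic Q ∧ ¬ IsPermMatrix Q ∧ A * Q = Q * B := by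
  obtain ⟨τ, rfl⟩ := hP₀
  obtain ⟨σ, rfl⟩ := hP
  have hT : (τ.permMatrix ℝ)ᵀ * τ.permMatrix ℝ = 1 := by
    rw [Matrix.transpose_permMatrix, ← Matrix.permMatrix_mul]; simp
  have hσ : ∃ i, σ i ≠ i := by
    by_contra! h
    apply hPne
    have : σ = 1 := Equiv.ext h
    subst this
    simp
  have e1 : (τ.permMatrix ℝ)ᵀ = (τ⁻¹).permMatrix ℝ := Matrix.transpose_permMatrix τ
  have e2 : σ.permMatrix ℝ * (τ.permMatrix ℝ)ᵀ = (τ⁻¹ * σ).permMatrix ℝ := by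
    rw [e1, Matrix.permMatrix_mul]
  have hQ : (1 / 2 : ℝ) • ((1 + σ.permMatrix ℝ) * (τ.permMatrix ℝ)ᵀ) =
      Matrix.of fun i j => (1 / 2 : ℝ) *
        ((if τ⁻¹ i = j then 1 else 0) + (if (τ⁻¹ * σ) i = j then 1 else 0)) := by
    rw [add_mul, one_mul, e2, e1]
    generalize τ⁻¹ * σ = π
    generalize τ⁻¹ = ρ
    ext i j
    simp [Equiv.Perm.permMatrix, PEquiv.toMatrix_apply, eq_comm]
  refine ⟨(1 / 2 : ℝ) • ((1 + σ.permMatrix ℝ) * (τ.permMatrix ℝ)ᵀ), ?_, ?_, ?_⟩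
  · rw [hQ]
    refine ⟨?_, ?_, ?_⟩
    · intro i j
      simp only [Matrix.of_apply]
      positivity
    · intro i
      simp only [Matrix.of_apply, ← Finset.mul_sum, Finset.sum_add_distrib]
      simp only [Finset.sum_ite_eq, Finset.mem_univ, if_true]
      norm_num
    · intro j
      simp only [Matrix.of_apply, ← Finset.mul_sum, Finset.sum_add_distrib,
        ← Equiv.Perm.eq_inv_iff_eq]
      simp only [Finset.sum_ite_eq', Finset.mem_univ, if_true]
      norm_num
  · rw [hQ]
    rintro ⟨χ, h⟩
    obtain ⟨i, hi⟩ := hσ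
    have h1 := congrFun (congrFun h i) (τ⁻¹ i)
    have h2 : (τ⁻¹ * σ) i ≠ τ⁻¹ i := by
      simpa [Equiv.Perm.mul_apply] using hi
    simp only [Matrix.of_apply, if_neg h2, if_true, Equiv.Perm.permMatrix,
      PEquiv.toMatrix_apply] at h1
    split_ifs at h1 <;> norm_num at h1
  · rw [hB, Matrix.mul_smul, Matrix.smul_mul]
    congr 1
    have h3 : A * (1 + σ.permMatrix ℝ) = (1 + σ.permMatrix ℝ) * A := by
      rw [mul_add, add_mul, hcomm, mul_one, one_mul]
    calc A * ((1 + σ.permMatrix ℝ) * (τ.permMatrix ℝ)ᵀ)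
        = (1 + σ.permMatrix ℝ) * A * (τ.permMatrix ℝ)ᵀ := by rw [← mul_assoc, h3]
      _ = (1 + σ.permMatrix ℝ) * ((τ.permMatrix ℝ)ᵀ * τ.permMatrix ℝ) * A
            * (τ.permMatrix ℝ)ᵀ := by rw [hT, mul_one]
      _ = _ := by simp only [mul_assoc]
end

section
/- Let A be a real symmetric n×n matrix with entries in {0,1}, and suppose u is an eigenvector of A with exactly two nonzero entries, located at indices s ≠ t, with u_s = −u_t (so uᵀ𝟏 = 0). Then A_{js} = A_{jt} for every index j ∉ {s,t} (nodes s and t have the same connectivity pattern with the rest of the graph), and the transposition permutation matrix P that swaps coordinates s and t and fixes all others satisfies AP = PA; in particular the graph has a nontrivial automorphism. -/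
open Matrix

/-- If `A` is a symmetric 0/1 matrix and `u` is an eigenvector of `A` with
exactly two nonzero entries, at positions `s ≠ t`, with `u s = -u t`, then
columns `s` and `t` of `A` agree outside `{s, t}`, and the transposition
swapping `s` and `t` gives a (nontrivial) automorphism: its permutation matrix
commutes with `A`. -/
theorem stmt_11 {n : ℕ} (A : Matrix (Fin n) (Fin n) ℝ) (hA : A.IsSymm)
    (h01 : ∀ i j, A i j = 0 ∨ A i j = 1)
    (u : Fin n → ℝ) (lam : ℝ) (heig : A.mulVec u = lam • u)
    (s t : Fin n) (hst : s ≠ t)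
    (hsupp : ∀ j, u j ≠ 0 ↔ (j = s ∨ j = t))
    (hopp : u s = -u t) :
    (∀ j, j ≠ s → j ≠ t → A j s = A j t) ∧
    A * (Equiv.swap s t).permMatrix ℝ = (Equiv.swap s t).permMatrix ℝ * A ∧
    (Equiv.swap s t).permMatrix ℝ ≠ (1 : Matrix (Fin n) (Fin n) ℝ) := by
  have hut : u t ≠ 0 := (hsupp t).2 (Or.inr rfl)
  have hrow : ∀ j, (A j t - A j s) * u t = lam * u j := by
    intro j
    have h := congrFun heig j
    have h2 : A.mulVec u j = A j s * u s + A j t * u t := by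
      rw [Matrix.mulVec, dotProduct, ← Finset.sum_pair (f := fun k => A j k * u k) hst]
      symm
      apply Finset.sum_subset (Finset.subset_univ _)
      intro k _ hk
      have hk0 : u k = 0 := by
        by_contra hne
        have := (hsupp k).1 hne
        simp at hk
        tauto
      simp [hk0]
    rw [h2, hopp] at h
    simp only [Pi.smul_apply, smul_eq_mul] at h
    linarith
  have h1 : ∀ j, j ≠ s → j ≠ t → A j s = A j t := by
    intro j hs ht
    have hj : u j = 0 := by
      by_contra hne
      have := (hsupp j).1 hne
      tauto
    have h := hrow j
    rw [hj, mul_zero] at h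
    rcases mul_eq_zero.1 h with h | h
    · linarith
    · exact absurd h hut
  have hsym : ∀ i j, A i j = A j i := fun i j => hA.apply j i
  have hdiag : A s s = A t t := by
    have hs := hrow s
    have ht := hrow t
    rw [hopp] at hs
    have h : (A t t - A s s) * u t = 0 := by
      rw [hsym s t] at hs
      linarith
    rcases mul_eq_zero.1 h with h | h
    · linarith
    · exact absurd h hut
  have hsw : ∀ i j, A (Equiv.swap s t i) (Equiv.swap s t j) = A i j := by
    intro i j
    by_cases his : i = s <;> by_cases hit : i = t <;> by_cases hjs : j = s <;>
      by_cases hjt : j = t <;>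
      simp_all [Equiv.swap_apply_of_ne_of_ne] <;> grind
  refine ⟨h1, ?_, ?_⟩
  · ext i j
    rw [Equiv.Perm.permMatrix, PEquiv.mul_toMatrix_toPEquiv, PEquiv.toMatrix_toPEquiv_mul]
    simp only [Matrix.submatrix_apply, id]
    rw [← hsw i]
    simp
  · intro h
    have := congrFun (congrFun h s) s
    simp [Equiv.Perm.permMatrix, PEquiv.toMatrix_apply, hst.symm] at this
end

section
/- Let A be a real symmetric n×n matrix with entries in {0,1} and n ≥ 2, and suppose A has an eigenvector u with exactly two nonzero entries satisfying uᵀ𝟏 = 0. Then there exists a doubly stochastic matrix Q that is not a permutation matrix and satisfies AQ = QA; in particular the graph matching problem and its convex relaxation over doubly stochastic matrices are not equivalent for this graph. -/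
open Matrix

/-- If a symmetric 0/1 matrix `A` (with `n ≥ 2`) has an eigenvector with exactly
two nonzero entries which is orthogonal to the all-ones vector, then there is a
doubly stochastic matrix, not a permutation matrix, commuting with `A`: the
graph matching problem and its convex relaxation are not equivalent for this
graph. -/
theorem stmt_13 {n : ℕ} (hn : 2 ≤ n)
    (A : Matrix (Fin n) (Fin n) ℝ) (hA : A.IsSymm)
    (h01 : ∀ i j, A i j = 0 ∨ A i j = 1)
    (u : Fin n → ℝ) (lam : ℝ) (heig : A.mulVec u = lam • u) (hu : u ≠ 0)
    (hsupp : {j | u j ≠ 0}.ncard = 2)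
    (hperp : u ⬝ᵥ (1 : Fin n → ℝ) = 0) :
    ∃ Q : Matrix (Fin n) (Fin n) ℝ,
      IsDoublyStochastic Q ∧ ¬ IsPermMatrix Q ∧ A * Q = Q * A := by
  obtain ⟨a, b, hab, hs⟩ := Set.ncard_eq_two.mp hsupp
  have hmem : ∀ j, u j ≠ 0 ↔ j = a ∨ j = b := by
    intro j
    have := Set.ext_iff.mp hs j
    simpa using this
  have ha : u a ≠ 0 := (hmem a).2 (Or.inl rfl)
  have hsum : ∑ j, u j = 0 := by simpa [dotProduct] using hperp
  have hb : u b = - u a := by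
    have h2 : ∑ j, u j = ∑ j ∈ ({a, b} : Finset (Fin n)), u j := by
      symm
      apply Finset.sum_subset (Finset.subset_univ _)
      intro j _ hj
      by_contra h
      apply hj
      simpa using (hmem j).1 h
    rw [Finset.sum_pair hab] at h2
    linarith
  have hu0 : ∀ j, j ≠ a → j ≠ b → u j = 0 := by
    intro j h1 h2
    by_contra h
    rcases (hmem j).1 h with h | h
    · exact h1 h
    · exact h2 h
  have hpos : 0 < u a * u a := mul_self_pos.mpr ha
  set c : ℝ := 1 / (2 * (u a * u a)) with hc
  have hca : c * (u a * u a) = 1 / 2 := by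
    rw [hc]; field_simp
  have hc0 : 0 < c := by positivity
  refine ⟨1 - c • vecMulVec u u, ⟨?_, ?_, ?_⟩, ?_, ?_⟩
  · intro i j
    simp only [Matrix.sub_apply, Matrix.smul_apply, vecMulVec_apply, smul_eq_mul, Matrix.one_apply]
    by_cases hia : i = a
    · by_cases hja : j = a
      · rw [hia, hja, if_pos rfl]; linarith
      · by_cases hjb : j = b
        · rw [hia, hjb, if_neg hab, hb]; linarith
        · rw [hu0 j hja hjb]; split_ifs <;> simp
    · by_cases hib : i = b
      · by_cases hja : j = a
        · rw [hib, hja, if_neg hab.symm, hb]; linarith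
        · by_cases hjb : j = b
          · rw [hib, hjb, if_pos rfl, hb]; linarith
          · rw [hu0 j hja hjb]; split_ifs <;> simp
      · rw [hu0 i hia hib]; split_ifs <;> simp
  · intro i
    simp [Matrix.sub_apply, vecMulVec_apply, Matrix.one_apply, ← Finset.mul_sum, hsum]
  · intro j
    simp [Matrix.sub_apply, vecMulVec_apply, Matrix.one_apply, ← Finset.mul_sum, ← Finset.sum_mul,
      hsum]
  · rintro ⟨σ, hσ⟩
    have h := congrFun (congrFun hσ a) a
    simp only [Matrix.sub_apply, Matrix.smul_apply, vecMulVec_apply, smul_eq_mul,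
      Matrix.one_apply_eq, hca, Equiv.Perm.permMatrix, PEquiv.toMatrix_apply] at h
    split_ifs at h <;> norm_num at h
  · have h2 : u ᵥ* A = lam • u := by
      rw [← heig, ← Matrix.vecMul_transpose, hA.eq]
    rw [mul_sub, sub_mul, mul_one, one_mul, Matrix.mul_smul, Matrix.smul_mul,
      Matrix.mul_vecMulVec, Matrix.vecMulVec_mul, heig, h2, Matrix.smul_vecMulVec,
      Matrix.vecMulVec_smul]
end

section
/- Let L be a real symmetric n×n matrix satisfying L𝟏 = 0, L_{ij} ≤ 0 for all i ≠ j, and having at least 2k+1 strictly positive diagonal entries (for some integer k ≥ 0). Then rank(L) ≥ k+1. -/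
lemma aux_card_le_rank {n : ℕ} (L : Matrix (Fin n) (Fin n) ℝ)
    (hrow : ∀ i, ∑ j, L i j = 0)
    (hoff : ∀ i j, i ≠ j → L i j ≤ 0) (S : Finset (Fin n))
    (hS : ∀ i ∈ S, ∃ j, j ∉ S ∧ L i j < 0) : S.card ≤ L.rank := by
  classical
  have hdet : (L.submatrix (fun i : S => (i : Fin n)) (fun i : S => (i : Fin n))).det ≠ 0 := by
    apply det_ne_zero_of_sum_row_lt_diag
    rintro ⟨i, hi⟩
    obtain ⟨j, hj, hij⟩ := hS i hi
    have h1 : ∑ x ∈ Finset.univ.erase (⟨i, hi⟩ : S), ‖L i x‖ = ∑ x ∈ S.erase i, -L i x := by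
      have h3 : ∑ x ∈ Finset.univ.erase (⟨i, hi⟩ : S), ‖L i x‖ = ∑ x : S, ‖L i x‖ - ‖L i i‖ := by
        rw [← Finset.sum_erase_add _ _ (Finset.mem_univ (⟨i, hi⟩ : S))]; simp
      rw [h3, Finset.sum_coe_sort S (fun x => ‖L i x‖), ← Finset.sum_erase_add _ _ hi,
        add_sub_cancel_right]
      refine Finset.sum_congr rfl fun x hx => ?_
      rw [Real.norm_eq_abs, abs_of_nonpos (hoff _ _ (Finset.ne_of_mem_erase hx).symm)]
    have h2 : ∑ x ∈ S.erase i, -L i x < ∑ x ∈ Finset.univ.erase i, -L i x := by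
      apply Finset.sum_lt_sum_of_subset (i := j)
      · exact Finset.erase_subset_erase _ (Finset.subset_univ _)
      · simp only [Finset.mem_erase, Finset.mem_univ, and_true]
        rintro rfl; exact hj hi
      · simp [hj]
      · linarith
      · intro x hx _
        have := hoff i x (Finset.ne_of_mem_erase hx).symm
        linarith
    have h4 := hrow i
    rw [← Finset.sum_erase_add _ _ (Finset.mem_univ i)] at h4
    rw [Finset.sum_neg_distrib (s := Finset.univ.erase i)] at h2
    simp only [Matrix.submatrix_apply]
    rw [h1]
    exact lt_of_lt_of_le (by linarith) (le_abs_self (L i i))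
  have hr := Matrix.rank_of_isUnit _ ((Matrix.isUnit_iff_isUnit_det _).2 hdet.isUnit)
  rw [Fintype.card_coe] at hr
  rw [← hr]
  exact Matrix.rank_submatrix_le _ _ _

open Matrix

/-- A symmetric Laplacian-like matrix `L` with zero row sums, nonpositive
off-diagonal entries, and at least `2k+1` strictly positive diagonal entries
has rank at least `k+1`. -/
theorem stmt_14 {n k : ℕ} (L : Matrix (Fin n) (Fin n) ℝ) (hL : L.IsSymm)
    (hrow : L.mulVec (1 : Fin n → ℝ) = 0)
    (hoff : ∀ i j, i ≠ j → L i j ≤ 0)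
    (hdiag : 2 * k + 1 ≤ {i | 0 < L i i}.ncard) :
    k + 1 ≤ L.rank := by
  classical
  have hrow' : ∀ i, ∑ j, L i j = 0 := fun i => by
    have := congrFun hrow i
    simpa [Matrix.mulVec, dotProduct] using this
  set P : Finset (Fin n) := Finset.univ.filter fun i => 0 < L i i with hP
  have hPc : 2 * k + 1 ≤ P.card := by
    have : {i | 0 < L i i} = (P : Set (Fin n)) := by ext; simp [hP]
    rwa [this, Set.ncard_coe_finset] at hdiag
  let F := P.powerset.filter fun S => ∀ i ∈ S, ∃ j, j ∉ S ∧ L i j < 0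
  obtain ⟨S, hSF, hmax⟩ := F.exists_max_image Finset.card ⟨∅, by simp [F]⟩
  obtain ⟨hSP, hS⟩ : S ⊆ P ∧ ∀ i ∈ S, ∃ j, j ∉ S ∧ L i j < 0 := by simpa [F] using hSF
  have h1 := aux_card_le_rank L hrow' hoff S hS
  have h2 := aux_card_le_rank L hrow' hoff (P \ S) (by
    intro v hv
    obtain ⟨hvP, hvS⟩ := Finset.mem_sdiff.1 hv
    by_contra! hcon
    have hno : ∀ w ∈ S, 0 ≤ L v w := fun w hw => hcon w (by simp [hw])
    have hmem : insert v S ∈ F := by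
      simp only [F, Finset.mem_filter, Finset.mem_powerset]
      refine ⟨Finset.insert_subset hvP hSP, fun i hi => ?_⟩
      rcases Finset.mem_insert.1 hi with rfl | hiS
      · by_contra! hc
        have hpos : 0 < L i i := by simpa [hP] using hvP
        have h4 := hrow' i
        rw [← Finset.sum_erase_add _ _ (Finset.mem_univ i)] at h4
        have : 0 ≤ ∑ x ∈ Finset.univ.erase i, L i x := by
          refine Finset.sum_nonneg fun x hx => ?_
          by_cases hxS : x ∈ S
          · exact hno x hxS
          · exact hc x (by simp [hxS, Finset.ne_of_mem_erase hx])
        linarith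
      · obtain ⟨j, hj, hij⟩ := hS i hiS
        refine ⟨j, ?_, hij⟩
        rw [Finset.mem_insert, not_or]
        refine ⟨?_, hj⟩
        rintro rfl
        have := hno i hiS
        rw [hL.apply] at this
        linarith
    have := hmax _ hmem
    rw [Finset.card_insert_of_notMem hvS] at this
    omega)
  have h3 := Finset.card_sdiff_add_card_eq_card hSP
  omega
end

section
/- Let A be a real symmetric n×n matrix with n distinct eigenvalues such that no eigenvector u of A satisfies uᵀ𝟏 = 0 (i.e., A is the adjacency matrix of a friendly graph). Then the only doubly stochastic matrix Q satisfying AQ = QA is the identity matrix. -/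
open Matrix

/-- The friendly-graph result: if the symmetric matrix `A` has simple spectrum
(an orthonormal eigenbasis with distinct eigenvalues) and no eigenvector of `A`
is orthogonal to the all-ones vector, then the only doubly stochastic matrix
commuting with `A` is the identity. -/
theorem stmt_15 {n : ℕ} (A : Matrix (Fin n) (Fin n) ℝ) (hA : A.IsSymm)
    (μ : Fin n → ℝ) (w : Fin n → (Fin n → ℝ))
    (hμ : Function.Injective μ)
    (heig : ∀ i, A.mulVec (w i) = μ i • w i)
    (horth : ∀ i j, w i ⬝ᵥ w j = if i = j then (1 : ℝ) else 0)
    (hfriendly : ∀ (lam : ℝ) (u : Fin n → ℝ), u ≠ 0 → A.mulVec u = lam • u →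
      u ⬝ᵥ (1 : Fin n → ℝ) ≠ 0)
    (Q : Matrix (Fin n) (Fin n) ℝ) (hQ : IsDoublyStochastic Q)
    (hcomm : A * Q = Q * A) : Q = 1 := by
  have hfix : ∀ i, Q *ᵥ w i = w i := by
    intro i
    by_contra hne
    refine hfriendly (μ i) (Q *ᵥ w i - w i) (sub_ne_zero.mpr hne) ?_ ?_
    · rw [mulVec_sub, mulVec_mulVec, hcomm, ← mulVec_mulVec, heig, mulVec_smul, smul_sub]
    · have h1 : (1 : Fin n → ℝ) ᵥ* Q = 1 := by
        funext j
        simpa [vecMul, dotProduct] using hQ.2.2 j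
      rw [dotProduct_comm, dotProduct_sub, dotProduct_mulVec, h1, sub_self]
  have hW : Matrix.of w * (Matrix.of w)ᵀ = 1 := by
    ext i j
    rw [one_apply, ← horth i j]
    rfl
  have hW' := mul_eq_one_comm.mp hW
  have hQW : Q * (Matrix.of w)ᵀ = (Matrix.of w)ᵀ := by
    ext k i
    exact congrFun (hfix i) k
  calc Q = Q * ((Matrix.of w)ᵀ * Matrix.of w) := by rw [hW', mul_one]
    _ = 1 := by rw [← Matrix.mul_assoc, hQW, hW']
end
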